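/- arXiv:1608.01002 — 3 statements merged into one kernel-verified Lean document; each statement's English description precedes it below -/
import Mathlib

section
/- Let d > 2 be an integer and let z ∈ ℂ with Re z > 0. Then lim_{m→0⁺} (1/(2π)) (m/(2πz))^(d/2−1) K_{d/2−1}(mz) = Γ(d/2 − 1) / ( 4 π^(d/2) z^(d−2) ), where the complex power (m/(2πz))^(d/2−1) is taken with the principal branch. -/
open MeasureTheory Filter
open scoped Topology

/-- The modified Bessel function of the second kind `K_ν(z)`, for `Re z > 0` and real order `ν`,
given by `K_ν(z) = ∫₀^∞ e^(−z cosh t) cosh(νt) dt`. -/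
noncomputable def besselK (ν : ℝ) (z : ℂ) : ℂ :=
  ∫ t in Set.Ioi (0 : ℝ), Complex.exp (-z * (Real.cosh t : ℂ)) * (Real.cosh (ν * t) : ℂ)

open Set

/-- The Laplace transform of a real power on the right half-plane. -/
theorem integral_rpow_mul_cexp_neg_mul_Ioi {ν : ℝ} (hν : 0 < ν) {r : ℂ} (hr : 0 < r.re) :
    ∫ t in Ioi (0 : ℝ), ((t ^ (ν - 1) : ℝ) : ℂ) * Complex.exp (-r * t) =
      r⁻¹ ^ (ν : ℂ) * (Real.Gamma ν : ℂ) := by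
  set μ : Measure ℝ := (volume.restrict (Ioi 0)).withDensity
    fun t => ((t ^ (ν - 1)).toNNReal : ENNReal) with hμ
  have hmeas : Measurable fun t : ℝ => (t ^ (ν - 1)).toNNReal := by fun_prop
  have hsub : Iio 0 ⊆ ProbabilityTheory.integrableExpSet id μ := by
    intro s hs
    simp only [ProbabilityTheory.integrableExpSet, mem_ofPred_eq, id]
    rw [hμ, integrable_withDensity_iff_integrable_coe_smul hmeas]
    have h : IntegrableOn (fun t : ℝ => t ^ (ν - 1) * Real.exp (s * t)) (Ioi 0) := by
      simpa using integrableOn_rpow_mul_exp_neg_mul_rpow (p := 1) (s := ν - 1)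
        (b := -s) (by linarith) one_pos (neg_pos.mpr hs)
    refine IntegrableOn.congr_fun h (fun t ht => ?_) measurableSet_Ioi
    rw [Real.coe_toNNReal _ (Real.rpow_nonneg (le_of_lt ht) _), smul_eq_mul]
  have hmgf : ∀ w : ℂ, ProbabilityTheory.complexMGF id μ (-w) =
      ∫ t in Ioi (0 : ℝ), ((t ^ (ν - 1) : ℝ) : ℂ) * Complex.exp (-w * t) := by
    intro w
    rw [ProbabilityTheory.complexMGF, hμ, integral_withDensity_eq_integral_smul hmeas]
    refine setIntegral_congr_fun measurableSet_Ioi fun t ht => ?_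
    simp only [NNReal.smul_def, Real.coe_toNNReal _ (Real.rpow_nonneg (le_of_lt ht) _), id,
      Complex.real_smul]
  have hopen : IsOpen {w : ℂ | 0 < w.re} := isOpen_lt continuous_const Complex.continuous_re
  have hf : AnalyticOnNhd ℂ (fun w => ProbabilityTheory.complexMGF id μ (-w))
      {w | 0 < w.re} := by
    refine ProbabilityTheory.analyticOnNhd_complexMGF.comp analyticOnNhd_id.neg fun w hw => ?_
    exact interior_maximal hsub isOpen_Iio (by simpa using hw)
  have hg : AnalyticOnNhd ℂ (fun w : ℂ => w⁻¹ ^ (ν : ℂ) * (Real.Gamma ν : ℂ))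
      {w | 0 < w.re} := by
    refine DifferentiableOn.analyticOnNhd (fun w hw => ?_) hopen
    have hw : 0 < w.re := hw
    have hw0 : w ≠ 0 := by rintro rfl; simp at hw
    have hslit : w⁻¹ ∈ Complex.slitPlane := by
      refine Or.inl ?_
      rw [Complex.inv_re]
      exact div_pos hw (Complex.normSq_pos.mpr hw0)
    exact (((differentiableAt_inv hw0).cpow_const hslit).mul_const _).differentiableWithinAt
  have hreal : ∃ᶠ x : ℝ in 𝓝[≠] 1, ProbabilityTheory.complexMGF id μ (-(x : ℂ)) =
      (x : ℂ)⁻¹ ^ (ν : ℂ) * (Real.Gamma ν : ℂ) := by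
    refine Eventually.frequently (eventually_nhdsWithin_of_eventually_nhds ?_)
    filter_upwards [lt_mem_nhds one_pos] with x hx
    rw [hmgf, ← Complex.Gamma_ofReal, ← one_div,
      ← Complex.integral_cpow_mul_exp_neg_mul_Ioi (by simpa using hν) hx]
    refine setIntegral_congr_fun measurableSet_Ioi fun t ht => ?_
    push_cast [Complex.ofReal_cpow (le_of_lt ht)]
    rw [neg_mul]
  have hcoe : Tendsto (fun x : ℝ => (x : ℂ)) (𝓝[≠] 1) (𝓝[≠] ((1 : ℝ) : ℂ)) :=
    Complex.continuous_ofReal.continuousWithinAt.tendsto_nhdsWithin fun x hx => by simpa using hx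
  rw [← hmgf]
  exact hf.eqOn_of_preconnected_of_frequently_eq hg
    (convex_halfSpace_re_gt 0).isPreconnected (by simp) (hcoe.frequently hreal) hr

/-- Positive real factors split off from complex powers. -/
theorem ofReal_mul_cpow {x : ℝ} (hx : 0 < x) (w : ℂ) (s : ℝ) (hw : w ≠ 0) :
    ((x : ℂ) * w) ^ (s : ℂ) = ((x ^ s : ℝ) : ℂ) * w ^ (s : ℂ) := by
  have hxc : (x : ℂ) ≠ 0 := Complex.ofReal_ne_zero.mpr hx.ne'
  rw [Complex.ofReal_cpow hx.le, Complex.cpow_def_of_ne_zero (mul_ne_zero hxc hw),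
    Complex.log_ofReal_mul hx hw, Complex.ofReal_log hx.le, add_mul, Complex.exp_add,
    ← Complex.cpow_def_of_ne_zero hxc, ← Complex.cpow_def_of_ne_zero hw]

/-- The substitution `v = m * exp t` in the integral defining `K_ν(m z)`. -/
theorem rpow_mul_besselK_eq_integral (ν : ℝ) (z : ℂ) {m : ℝ} (hm : 0 < m) :
    ((m ^ ν : ℝ) : ℂ) * besselK ν ((m : ℂ) * z) =
      ∫ v in Ioi m, Complex.exp (-z * (((v + m ^ 2 / v) / 2 : ℝ) : ℂ)) *
        (((v ^ (ν - 1) + m ^ (2 * ν) * v ^ (-ν - 1)) / 2 : ℝ) : ℂ) := by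
  have himage : (fun t : ℝ => m * Real.exp t) '' Ioi 0 = Ioi m := by
    ext v
    simp only [mem_image, mem_Ioi]
    constructor
    · rintro ⟨t, ht, rfl⟩
      exact lt_mul_of_one_lt_right hm (Real.one_lt_exp_iff.mpr ht)
    · intro hv
      refine ⟨Real.log (v / m), Real.log_pos ((one_lt_div hm).mpr hv), ?_⟩
      rw [Real.exp_log (div_pos (hm.trans hv) hm), mul_div_cancel₀ _ hm.ne']
  rw [← himage, integral_image_eq_integral_abs_deriv_smul measurableSet_Ioi
    (fun t _ => ((Real.hasDerivAt_exp t).const_mul m).hasDerivWithinAt)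
    (fun s _ t _ h => Real.exp_injective (mul_left_cancel₀ hm.ne' h)), besselK,
    ← integral_const_mul]
  refine setIntegral_congr_fun measurableSet_Ioi fun t _ => ?_
  have he : 0 < Real.exp t := Real.exp_pos t
  have hcosh : (m * Real.exp t + m ^ 2 / (m * Real.exp t)) / 2 = m * Real.cosh t := by
    rw [Real.cosh_eq, Real.exp_neg]
    field_simp
  have hweight : m ^ ν * Real.cosh (ν * t) = (m * Real.exp t) *
      (((m * Real.exp t) ^ (ν - 1) + m ^ (2 * ν) * (m * Real.exp t) ^ (-ν - 1)) / 2) := by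
    have hv : 0 < m * Real.exp t := mul_pos hm he
    rw [Real.rpow_sub_one hv.ne', Real.rpow_sub_one hv.ne', Real.mul_rpow hm.le he.le,
      Real.mul_rpow hm.le he.le, ← Real.exp_mul, ← Real.exp_mul, Real.cosh_eq,
      two_mul, Real.rpow_add hm, Real.rpow_neg hm.le]
    have hmν : 0 < m ^ ν := Real.rpow_pos_of_pos hm ν
    rw [show t * -ν = -(ν * t) by ring, mul_comm t ν]
    field_simp
  simp only [hcosh, abs_of_pos (mul_pos hm he), Complex.real_smul]
  have hweight' := congrArg (fun x : ℝ => (x : ℂ)) hweight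
  simp only [Complex.ofReal_mul] at hweight'
  rw [mul_left_comm, hweight', mul_left_comm]
  push_cast
  ring_nf

/-- Small-argument asymptotics of `K_ν` for `ν > 0`. -/
theorem tendsto_rpow_mul_besselK {ν : ℝ} (hν : 0 < ν) {z : ℂ} (hz : 0 < z.re) :
    Tendsto (fun m : ℝ => ((m ^ ν : ℝ) : ℂ) * besselK ν ((m : ℂ) * z)) (𝓝[>] 0)
      (𝓝 (((z / 2)⁻¹) ^ (ν : ℂ) * (Real.Gamma ν : ℂ) / 2)) := by
  have hz2 : 0 < (z / 2).re := by simpa using hz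
  set F : ℝ → ℝ → ℂ := fun m v => Complex.exp (-z * (((v + m ^ 2 / v) / 2 : ℝ) : ℂ)) *
    (((v ^ (ν - 1) + m ^ (2 * ν) * v ^ (-ν - 1)) / 2 : ℝ) : ℂ) with hF
  have hlim : Tendsto (fun m : ℝ => ∫ v in Ioi (0 : ℝ), (Ioi m).indicator (F m) v) (𝓝[>] 0)
      (𝓝 (∫ v in Ioi (0 : ℝ), F 0 v)) := by
    refine tendsto_integral_filter_of_dominated_convergence
      (fun v => v ^ (ν - 1) * Real.exp (-(z.re / 2) * v)) ?_ ?_ ?_ ?_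
    · refine Eventually.of_forall fun m => ?_
      exact (Measurable.indicator (by fun_prop) measurableSet_Ioi).aestronglyMeasurable
    · filter_upwards [self_mem_nhdsWithin] with m hm
      filter_upwards [ae_restrict_mem measurableSet_Ioi] with v hv
      replace hm : 0 < m := hm
      replace hv : 0 < v := hv
      by_cases hmv : v ∈ Ioi m
      · have hle : m ^ (2 * ν) * v ^ (-ν - 1) ≤ v ^ (ν - 1) := by
          calc m ^ (2 * ν) * v ^ (-ν - 1) ≤ v ^ (2 * ν) * v ^ (-ν - 1) := by
                gcongr
                exact le_of_lt hmv
            _ = v ^ (ν - 1) := by rw [← Real.rpow_add hv]; ring_nf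
        have h0 : 0 ≤ v ^ (ν - 1) := Real.rpow_nonneg hv.le _
        have h1 : 0 ≤ m ^ (2 * ν) * v ^ (-ν - 1) := by positivity
        rw [indicator_of_mem hmv, hF, norm_mul, Complex.norm_exp, Complex.re_mul_ofReal,
          Complex.norm_real, Real.norm_of_nonneg (by positivity), mul_comm, Complex.neg_re]
        gcongr ?_ * Real.exp ?_
        · linarith
        · have h2 : 0 ≤ z.re * (m ^ 2 / v) := by positivity
          nlinarith
      · rw [indicator_of_notMem hmv, norm_zero]
        positivity
    · have h : IntegrableOn (fun v : ℝ => v ^ (ν - 1) * Real.exp (-(z.re / 2) * v)) (Ioi 0) := by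
        simpa using integrableOn_rpow_mul_exp_neg_mul_rpow (p := 1) (s := ν - 1)
          (b := z.re / 2) (by linarith) one_pos (half_pos hz)
      exact h
    · filter_upwards [ae_restrict_mem measurableSet_Ioi] with v hv
      have hcont : Tendsto (fun m => F m v) (𝓝[>] 0) (𝓝 (F 0 v)) := by
        have : Continuous fun m => F m v := by
          have := Real.continuous_rpow_const (q := 2 * ν) (by positivity)
          fun_prop
        exact this.continuousAt.mono_left nhdsWithin_le_nhds
      refine hcont.congr' ?_
      filter_upwards [Ioo_mem_nhdsGT (show (0 : ℝ) < v from hv)] with m hm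
      exact (indicator_of_mem (show v ∈ Ioi m from hm.2) _).symm
  have hF0 : ∫ v in Ioi (0 : ℝ), F 0 v = ((z / 2)⁻¹) ^ (ν : ℂ) * (Real.Gamma ν : ℂ) / 2 := by
    rw [← integral_rpow_mul_cexp_neg_mul_Ioi hν hz2, ← integral_div]
    refine setIntegral_congr_fun measurableSet_Ioi fun v hv => ?_
    have hv : 0 < v := hv
    simp only [hF, Real.zero_rpow (show 2 * ν ≠ 0 by positivity)]
    push_cast
    ring_nf
  rw [hF0] at hlim
  refine hlim.congr' ?_
  filter_upwards [self_mem_nhdsWithin] with m hm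
  rw [rpow_mul_besselK_eq_integral ν z hm, setIntegral_indicator measurableSet_Ioi,
    Ioi_inter_Ioi, sup_of_le_right (le_of_lt hm)]

/-- For `d > 2`, the massless limit of the scalar Wightman function:
`lim_{m→0⁺} (1/2π) (m/(2πz))^(d/2−1) K_{d/2−1}(mz) = Γ(d/2−1)/(4π^(d/2) z^(d−2))`,
with the complex power taken in the principal branch. -/
theorem massless_limit_scalar_wightman (d : ℕ) (hd : 2 < d) (z : ℂ) (hz : 0 < z.re) :
    Tendsto (fun m : ℝ =>
        (1 / (2 * (Real.pi : ℂ))) * ((m : ℂ) / (2 * (Real.pi : ℂ) * z)) ^ ((d : ℂ) / 2 - 1) *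
          besselK ((d : ℝ) / 2 - 1) ((m : ℂ) * z))
      (𝓝[>] 0)
      (𝓝 ((Real.Gamma ((d : ℝ) / 2 - 1) : ℂ) /
        (4 * ((Real.pi ^ ((d : ℝ) / 2) : ℝ) : ℂ) * z ^ (d - 2)))) := by
  have hd' : (2 : ℝ) < d := by exact_mod_cast hd
  set ν : ℝ := (d : ℝ) / 2 - 1 with hνd
  have hν : 0 < ν := by linarith
  have hνc : (d : ℂ) / 2 - 1 = (ν : ℂ) := by rw [hνd]; push_cast; rfl
  have hz0 : z ≠ 0 := by rintro rfl; simp at hz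
  have hpi := Real.pi_pos
  have hsq : z⁻¹ ^ (ν : ℂ) * z⁻¹ ^ (ν : ℂ) = (z ^ (d - 2))⁻¹ := by
    rw [← Complex.cpow_add _ _ (inv_ne_zero hz0), ← inv_pow, ← Complex.cpow_natCast,
      Nat.cast_sub hd.le, ← hνc]
    congr 1
    push_cast
    ring
  have hconst : (1 / (2 * Real.pi)) * (2 * Real.pi) ^ (-ν) * 2 ^ ν / 2 =
      (4 * Real.pi ^ ((d : ℝ) / 2))⁻¹ := by
    rw [show (d : ℝ) / 2 = ν + 1 by rw [hνd]; ring, Real.rpow_add_one hpi.ne',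
      Real.rpow_neg (by positivity), Real.mul_rpow (by norm_num) hpi.le]
    field_simp
    norm_num
  have hconst' := congrArg (fun x : ℝ => (x : ℂ)) hconst
  push_cast at hconst'
  have hlim := (tendsto_rpow_mul_besselK hν hz).const_mul
    (((1 / (2 * Real.pi) * (2 * Real.pi) ^ (-ν) : ℝ) : ℂ) * z⁻¹ ^ (ν : ℂ))
  convert hlim.congr' ?_ using 2
  · rw [show (z / 2)⁻¹ = ((2 : ℝ) : ℂ) * z⁻¹ by push_cast; field_simp, ofReal_mul_cpow two_pos _ _ (inv_ne_zero hz0)]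
    push_cast
    rw [div_eq_mul_inv, mul_inv, ← hconst', ← hsq]
    ring
  · filter_upwards [self_mem_nhdsWithin] with m hm
    have hm : 0 < m := hm
    rw [hνc, show (m : ℂ) / (2 * (Real.pi : ℂ) * z) = ((m / (2 * Real.pi) : ℝ) : ℂ) * z⁻¹ by
      push_cast; field_simp, ofReal_mul_cpow (by positivity) _ _ (inv_ne_zero hz0), Real.div_rpow hm.le (by positivity),
      Real.rpow_neg (by positivity)]
    push_cast
    ring
end

section
/- Let σ > 0, L > 0, β ∈ ℝ, Ω ∈ ℝ, θ ∈ [0,1], and let χ(τ) = π^(−1/4) σ^(−1/2) e^(−τ²/(2σ²)). Write Δτ = τ − τ', u_ε = e^β Δτ − iε, v_ε = e^(−β) Δτ − iε. Then lim_{ε→0⁺} ∫∫ χ(τ)χ(τ') e^(−iΩΔτ) [ − e^(−2πi(Δτ cosh β − iε)/L) / ( 2L² sin(πu_ε/L) sin(πv_ε/L) ) + (1/L²)( 1/(e^(2πiu_ε/L) − 1) + 1/(e^(2πiv_ε/L) − 1) ) + θ/L² ] dτ dτ' = (4π^(1/2)σ/L²) Σ_{n,m=1}^∞ exp[−σ²(Ω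 + 2π(n e^β + m e^(−β))/L)²] + (2π^(1/2)σ/L²) Σ_{n=1}^∞ { exp[−σ²(Ω + 2πn e^β/L)²] + exp[−σ²(Ω + 2πn e^(−β)/L)²] } + (2π^(1/2)σθ/L²) e^(−σ²Ω²). -/
open MeasureTheory Filter
open scoped Topology

/-- Labels of the modes excited in the response: pairs of right- and left-moving oscillator
excitations, a single right-moving or left-moving excitation, and the pure zero-mode term. -/
abbrev ModeIndex := (ℕ × ℕ) ⊕ (ℕ ⊕ ℕ) ⊕ Unit

namespace ModeIndex

/-- Numbers of right- and left-moving momentum quanta. -/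
def quanta : ModeIndex → ℕ × ℕ :=
  Sum.elim (fun p => (p.1 + 1, p.2 + 1))
    (Sum.elim (Sum.elim (fun n => (n + 1, 0)) fun n => (0, n + 1)) fun _ => (0, 0))

/-- Multiplicity with which a mode contributes to the correlation function. -/
def weight (θ : ℂ) : ModeIndex → ℂ :=
  Sum.elim (fun _ => 2) (Sum.elim (fun _ => 1) fun _ => θ)

theorem hasSum_weight_mul (θ : ℂ) {f : ℕ × ℕ → ℂ} (hf : Summable f) :
    HasSum (fun i => weight θ i * f (quanta i))
      (2 * ∑' p : ℕ × ℕ, f (p.1 + 1, p.2 + 1)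
        + (∑' n : ℕ, f (n + 1, 0) + ∑' n : ℕ, f (0, n + 1) + θ * f (0, 0))) := by
  have pairs : Summable fun p : ℕ × ℕ => f (p.1 + 1, p.2 + 1) :=
    hf.comp_injective (i := fun p : ℕ × ℕ => (p.1 + 1, p.2 + 1)) fun p q h => by
      simpa [Prod.ext_iff] using h
  have right : Summable fun n : ℕ => f (n + 1, 0) :=
    hf.comp_injective (i := fun n : ℕ => (n + 1, 0)) fun p q h => by simpa using h
  have left : Summable fun n : ℕ => f (0, n + 1) :=
    hf.comp_injective (i := fun n : ℕ => (0, n + 1)) fun p q h => by simpa using h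
  refine HasSum.sum (by simpa [Function.comp_def, weight, quanta] using pairs.hasSum.mul_left 2)
    (HasSum.sum (HasSum.sum ?_ ?_) ?_)
  · simpa [Function.comp_def, weight, quanta] using right.hasSum
  · simpa [Function.comp_def, weight, quanta] using left.hasSum
  · exact hasSum_unique fun _ : Unit => θ * f (0, 0)

end ModeIndex

theorem tsum_geometric_succ {q : ℂ} (hq : ‖q‖ < 1) : ∑' n : ℕ, q ^ (n + 1) = q / (1 - q) := by
  simp_rw [pow_succ']
  rw [tsum_mul_left, tsum_geometric_of_norm_lt_one hq, div_eq_mul_inv]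

theorem summable_norm_pow_mul_pow {q r : ℂ} (hq : ‖q‖ < 1) (hr : ‖r‖ < 1) :
    Summable fun p : ℕ × ℕ => ‖q ^ p.1 * r ^ p.2‖ := by
  simp_rw [norm_mul, norm_pow]
  exact (summable_geometric_of_lt_one (norm_nonneg q) hq).mul_of_nonneg
    (summable_geometric_of_lt_one (norm_nonneg r) hr)
    (fun n => by positivity) (fun n => by positivity)

theorem ModeIndex.hasSum_weight_mul_pow (θ : ℂ) {q r : ℂ} (hq : ‖q‖ < 1) (hr : ‖r‖ < 1) :
    HasSum (fun i => weight θ i * (q ^ (quanta i).1 * r ^ (quanta i).2))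
      (2 * (q / (1 - q) * (r / (1 - r))) + (q / (1 - q) + r / (1 - r) + θ)) := by
  have h := hasSum_weight_mul θ (summable_norm_pow_mul_pow hq hr).of_norm
  have hpair : ∑' p : ℕ × ℕ, q ^ (p.1 + 1) * r ^ (p.2 + 1) = q / (1 - q) * (r / (1 - r)) := by
    have norm_summable {x : ℂ} (hx : ‖x‖ < 1) : Summable fun n : ℕ => ‖x ^ (n + 1)‖ := by
      simp_rw [norm_pow]
      exact (summable_nat_add_iff 1).2 (summable_geometric_of_lt_one (norm_nonneg x) hx)
    rw [← tsum_geometric_succ hq, ← tsum_geometric_succ hr]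
    exact (tsum_mul_tsum_of_summable_norm (norm_summable hq) (norm_summable hr)).symm
  simpa [hpair, tsum_geometric_succ hq, tsum_geometric_succ hr] using h

theorem ModeIndex.summable_norm_weight_mul (θ : ℂ) {f : ℕ × ℕ → ℂ} (hf : Summable f) :
    Summable fun i => ‖weight θ i * f (quanta i)‖ :=
  (hasSum_weight_mul θ hf).summable.norm

/-- The closed-form untwisted correlation function in terms of `q = exp (-2πi u / L)` and
`r = exp (-2πi v / L)`. -/
theorem untwisted_kernel_eq {L : ℂ} (θ : ℂ) (hL : L ≠ 0) {u v s : ℂ} (hs : u + v = 2 * s)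
    (hu : Complex.exp (-2 * (Real.pi : ℂ) * Complex.I * u / L) ≠ 1)
    (hv : Complex.exp (-2 * (Real.pi : ℂ) * Complex.I * v / L) ≠ 1) :
    -Complex.exp (-2 * (Real.pi : ℂ) * Complex.I * s / L) /
        (2 * L ^ 2 * Complex.sin ((Real.pi : ℂ) * u / L) * Complex.sin ((Real.pi : ℂ) * v / L))
      + (1 / L ^ 2) * (1 / (Complex.exp (2 * (Real.pi : ℂ) * Complex.I * u / L) - 1)
          + 1 / (Complex.exp (2 * (Real.pi : ℂ) * Complex.I * v / L) - 1))
      + θ / L ^ 2 =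
    (1 / L ^ 2) * (2 * (Complex.exp (-2 * (Real.pi : ℂ) * Complex.I * u / L) /
          (1 - Complex.exp (-2 * (Real.pi : ℂ) * Complex.I * u / L)) *
        (Complex.exp (-2 * (Real.pi : ℂ) * Complex.I * v / L) /
          (1 - Complex.exp (-2 * (Real.pi : ℂ) * Complex.I * v / L))))
      + (Complex.exp (-2 * (Real.pi : ℂ) * Complex.I * u / L) /
          (1 - Complex.exp (-2 * (Real.pi : ℂ) * Complex.I * u / L))
        + Complex.exp (-2 * (Real.pi : ℂ) * Complex.I * v / L) /
          (1 - Complex.exp (-2 * (Real.pi : ℂ) * Complex.I * v / L)) + θ)) := by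
  have neg_sq (x : ℂ) : Complex.exp (-2 * (Real.pi : ℂ) * Complex.I * x / L) =
      ((Complex.exp ((Real.pi : ℂ) * x / L * Complex.I)) ^ 2)⁻¹ := by
    rw [← Complex.exp_nat_mul, ← Complex.exp_neg]; congr 1; push_cast; ring
  have pos_sq (x : ℂ) : Complex.exp (2 * (Real.pi : ℂ) * Complex.I * x / L) =
      (Complex.exp ((Real.pi : ℂ) * x / L * Complex.I)) ^ 2 := by
    rw [← Complex.exp_nat_mul]; congr 1; push_cast; ring
  have sin_eq (x : ℂ) : Complex.sin ((Real.pi : ℂ) * x / L) =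
      ((Complex.exp ((Real.pi : ℂ) * x / L * Complex.I))⁻¹ -
        Complex.exp ((Real.pi : ℂ) * x / L * Complex.I)) * Complex.I / 2 := by
    rw [Complex.sin, neg_mul, Complex.exp_neg]
  have prefactor : Complex.exp (-2 * (Real.pi : ℂ) * Complex.I * s / L) =
      (Complex.exp ((Real.pi : ℂ) * u / L * Complex.I) *
        Complex.exp ((Real.pi : ℂ) * v / L * Complex.I))⁻¹ := by
    rw [← Complex.exp_add, ← Complex.exp_neg]; congr 1
    linear_combination (Real.pi * Complex.I / L) * hs
  rw [neg_sq] at hu hv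
  rw [prefactor, neg_sq u, neg_sq v, pos_sq, pos_sq, sin_eq, sin_eq]
  have hz := Complex.exp_ne_zero ((Real.pi : ℂ) * u / L * Complex.I)
  have hw := Complex.exp_ne_zero ((Real.pi : ℂ) * v / L * Complex.I)
  generalize Complex.exp ((Real.pi : ℂ) * u / L * Complex.I) = z at *
  generalize Complex.exp ((Real.pi : ℂ) * v / L * Complex.I) = w at *
  have hz1 : z ^ 2 - 1 ≠ 0 := fun h => hu (by rw [sub_eq_zero.1 h, inv_one])
  have hw1 : w ^ 2 - 1 ≠ 0 := fun h => hv (by rw [sub_eq_zero.1 h, inv_one])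
  have frac {x : ℂ} (hx : x ≠ 0) (hx1 : x ^ 2 - 1 ≠ 0) :
      (x ^ 2)⁻¹ / (1 - (x ^ 2)⁻¹) = 1 / (x ^ 2 - 1) := by
    field_simp
  have sine {x : ℂ} (hx : x ≠ 0) : x⁻¹ - x = -(x ^ 2 - 1) / x := by
    field_simp; ring
  rw [frac hz hz1, frac hw hw1, sine hz, sine hw]
  have main : -(z * w)⁻¹ / (2 * L ^ 2 * (-(z ^ 2 - 1) / z * Complex.I / 2) *
      (-(w ^ 2 - 1) / w * Complex.I / 2)) =
      (1 / L ^ 2) * (2 * (1 / (z ^ 2 - 1) * (1 / (w ^ 2 - 1)))) := by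
    generalize z ^ 2 - 1 = a at *
    generalize w ^ 2 - 1 = b at *
    have hI := Complex.I_ne_zero
    field_simp
    linear_combination -Complex.I_sq
  rw [main]
  ring

theorem summable_exp_neg_sq_modes {σ L : ℝ} (hσ : 0 < σ) (hL : 0 < L) (β Ω : ℝ) :
    Summable fun p : ℕ × ℕ => Real.exp (-σ ^ 2 *
      (Ω + 2 * Real.pi * ((p.1 : ℝ) * Real.exp β + (p.2 : ℝ) * Real.exp (-β)) / L) ^ 2) := by
  have geom (b : ℝ) : Summable fun n : ℕ =>
      Real.exp (-(σ ^ 2 * (4 * Real.pi * Real.exp b / L))) ^ n :=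
    summable_geometric_of_lt_one (Real.exp_nonneg _)
      (Real.exp_lt_one_iff.2 (neg_neg_of_pos (by positivity)))
  have prod := ((geom β).mul_of_nonneg (geom (-β)) (fun n => by positivity)
    (fun n => by positivity)).mul_left (Real.exp (-σ ^ 2 * (2 * Ω - 1)))
  refine Summable.of_nonneg_of_le (fun p => Real.exp_nonneg _) (fun p => ?_) prod
  rw [← Real.exp_nat_mul, ← Real.exp_nat_mul, ← Real.exp_add, ← Real.exp_add, Real.exp_le_exp]
  have h := mul_nonneg (sq_nonneg σ) (sq_nonneg (Ω + 2 * Real.pi *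
    ((p.1 : ℝ) * Real.exp β + (p.2 : ℝ) * Real.exp (-β)) / L - 1))
  linear_combination h

section Gaussian

variable {σ : ℝ} {χ : ℝ → ℝ}

theorem integrable_gaussian_switching (hσ : 0 < σ)
    (hχ : ∀ τ, χ τ = Real.pi ^ (-(1 : ℝ) / 4) * σ ^ (-(1 : ℝ) / 2) *
      Real.exp (-τ ^ 2 / (2 * σ ^ 2))) : Integrable χ := by
  have h := (integrable_exp_neg_mul_sq (b := 1 / (2 * σ ^ 2)) (by positivity)).const_mul
    (Real.pi ^ (-(1 : ℝ) / 4) * σ ^ (-(1 : ℝ) / 2))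
  refine h.congr (Eventually.of_forall fun τ => ?_)
  simp only [hχ]
  congr 2
  ring

theorem integral_gaussian_switching_mul_cexp (hσ : 0 < σ)
    (hχ : ∀ τ, χ τ = Real.pi ^ (-(1 : ℝ) / 4) * σ ^ (-(1 : ℝ) / 2) *
      Real.exp (-τ ^ 2 / (2 * σ ^ 2))) (ω : ℝ) :
    ∫ τ : ℝ, (χ τ : ℂ) * Complex.exp (Complex.I * ω * τ) =
      ((Real.pi ^ (-(1 : ℝ) / 4) * σ ^ (-(1 : ℝ) / 2) * Real.sqrt (2 * Real.pi * σ ^ 2) *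
        Real.exp (-σ ^ 2 * ω ^ 2 / 2) : ℝ) : ℂ) := by
  have hσ' : (σ : ℂ) ≠ 0 := by exact_mod_cast hσ.ne'
  have h := fourierIntegral_gaussian (b := ((1 / (2 * σ ^ 2) : ℝ) : ℂ))
    (by rw [Complex.ofReal_re]; positivity) ω
  have hsqrt : ((Real.pi : ℂ) / ((1 / (2 * σ ^ 2) : ℝ) : ℂ)) ^ (1 / 2 : ℂ) =
      (Real.sqrt (2 * Real.pi * σ ^ 2) : ℂ) := by
    rw [Real.sqrt_eq_rpow, Complex.ofReal_cpow (by positivity)]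
    congr 1
    · push_cast; field_simp
    · push_cast; rfl
  rw [hsqrt] at h
  calc ∫ τ : ℝ, (χ τ : ℂ) * Complex.exp (Complex.I * ω * τ)
      = ∫ τ : ℝ, ((Real.pi ^ (-(1 : ℝ) / 4) * σ ^ (-(1 : ℝ) / 2) : ℝ) : ℂ) *
          (Complex.exp (Complex.I * ω * τ) *
            Complex.exp (-((1 / (2 * σ ^ 2) : ℝ) : ℂ) * (τ : ℂ) ^ 2)) := by
        refine integral_congr_ae (Eventually.of_forall fun τ => ?_)
        simp only [hχ]
        rw [Complex.ofReal_mul, Complex.ofReal_exp, mul_assoc,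
          mul_comm (Complex.exp (Complex.I * ω * τ))]
        congr 3
        push_cast
        ring
    _ = _ := by
        have hexp : -(ω : ℂ) ^ 2 / (4 * ((1 / (2 * σ ^ 2) : ℝ) : ℂ)) =
            ((-σ ^ 2 * ω ^ 2 / 2 : ℝ) : ℂ) := by
          push_cast
          field_simp
          ring
        rw [integral_const_mul, h, hexp]
        push_cast
        ring

theorem gaussian_switching_amplitude_sq (hσ : 0 < σ) (ω : ℝ) :
    (Real.pi ^ (-(1 : ℝ) / 4) * σ ^ (-(1 : ℝ) / 2) * Real.sqrt (2 * Real.pi * σ ^ 2) *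
        Real.exp (-σ ^ 2 * ω ^ 2 / 2)) ^ 2 =
      2 * Real.sqrt Real.pi * σ * Real.exp (-σ ^ 2 * ω ^ 2) := by
  have hpi : (Real.pi ^ (-(1 : ℝ) / 4)) ^ 2 = (Real.sqrt Real.pi)⁻¹ := by
    rw [← Real.rpow_natCast, ← Real.rpow_mul Real.pi_pos.le, Real.sqrt_eq_rpow,
      ← Real.rpow_neg Real.pi_pos.le]
    norm_num
  have hs : (σ ^ (-(1 : ℝ) / 2)) ^ 2 = σ⁻¹ := by
    rw [← Real.rpow_natCast, ← Real.rpow_mul hσ.le, ← Real.rpow_neg_one]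
    norm_num
  rw [mul_pow, mul_pow, mul_pow, hpi, hs, Real.sq_sqrt (by positivity), ← Real.exp_nat_mul]
  have hsq := Real.sq_sqrt Real.pi_pos.le
  have : Real.sqrt Real.pi ≠ 0 := by positivity
  have hexp : ((2 : ℕ) : ℝ) * (-σ ^ 2 * ω ^ 2 / 2) = -σ ^ 2 * ω ^ 2 := by push_cast; ring
  rw [hexp]
  field_simp
  linear_combination -hsq

/-- A Gaussian-switched response to a kernel that is an absolutely convergent superposition of
plane waves is the superposition of the individual responses. -/
theorem hasSum_gaussian_response {ι : Type*} [Countable ι] (hσ : 0 < σ)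
    (hχ : ∀ τ, χ τ = Real.pi ^ (-(1 : ℝ) / 4) * σ ^ (-(1 : ℝ) / 2) *
      Real.exp (-τ ^ 2 / (2 * σ ^ 2)))
    {a : ι → ℂ} (ω : ι → ℝ) {K : ℝ → ℝ → ℂ} (ha : Summable fun i => ‖a i‖)
    (hK : ∀ τ τ' : ℝ,
      HasSum (fun i => a i * Complex.exp (-Complex.I * ω i * ((τ : ℂ) - τ'))) (K τ τ')) :
    HasSum (fun i => a i * ((2 * Real.sqrt Real.pi * σ * Real.exp (-σ ^ 2 * ω i ^ 2) : ℝ) : ℂ))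
      (∫ τ : ℝ, ∫ τ' : ℝ, ((χ τ * χ τ' : ℝ) : ℂ) * K τ τ') := by
  have hint := integrable_gaussian_switching hσ hχ
  set G : ℝ → ℝ := fun w => Real.pi ^ (-(1 : ℝ) / 4) * σ ^ (-(1 : ℝ) / 2) *
    Real.sqrt (2 * Real.pi * σ ^ 2) * Real.exp (-σ ^ 2 * w ^ 2 / 2) with hG
  have hfourier (w : ℝ) : ∫ τ : ℝ, (χ τ : ℂ) * Complex.exp (Complex.I * w * τ) = G w :=
    integral_gaussian_switching_mul_cexp hσ hχ w
  have norm_phase (w τ : ℝ) : ‖Complex.exp (Complex.I * w * τ)‖ = 1 := by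
    rw [mul_assoc, mul_comm, ← Complex.ofReal_mul, Complex.norm_exp_ofReal_mul_I]
  have hwave (w : ℝ) : Integrable fun τ : ℝ => (χ τ : ℂ) * Complex.exp (Complex.I * w * τ) := by
    refine hint.ofReal.mul_bdd (c := 1) (by fun_prop) (Eventually.of_forall fun τ => ?_)
    rw [norm_phase]
  have inner (τ : ℝ) :
      HasSum (fun i => a i * G (ω i) * ((χ τ : ℂ) * Complex.exp (Complex.I * (-ω i : ℝ) * τ)))
        (∫ τ' : ℝ, ((χ τ * χ τ' : ℝ) : ℂ) * K τ τ') := by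
    have h := hasSum_integral_of_summable_integral_norm (μ := volume)
      (F := fun i (τ' : ℝ) => a i * ((χ τ : ℂ) * Complex.exp (Complex.I * (-ω i : ℝ) * τ)) *
        ((χ τ' : ℂ) * Complex.exp (Complex.I * ω i * τ')))
      (fun i => (hwave (ω i)).const_mul _) (by
        simp only [norm_mul, norm_phase, mul_one]
        simp_rw [integral_const_mul]
        exact (ha.mul_right _).mul_right _)
    have value : ∫ τ' : ℝ, ((χ τ * χ τ' : ℝ) : ℂ) * K τ τ' = ∫ τ' : ℝ, ∑' i,
        a i * ((χ τ : ℂ) * Complex.exp (Complex.I * (-ω i : ℝ) * τ)) *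
          ((χ τ' : ℂ) * Complex.exp (Complex.I * ω i * τ')) := by
      refine integral_congr_ae (Eventually.of_forall fun τ' => ?_)
      simp only
      rw [← ((hK τ τ').mul_left ((χ τ * χ τ' : ℝ) : ℂ)).tsum_eq]
      refine tsum_congr fun i => ?_
      have hphase : Complex.exp (-Complex.I * ω i * ((τ : ℂ) - τ')) =
          Complex.exp (Complex.I * (-ω i : ℝ) * τ) * Complex.exp (Complex.I * ω i * τ') := by
        rw [← Complex.exp_add]; congr 1; push_cast; ring
      rw [hphase]
      push_cast
      ring
    rw [value]
    refine (congrArg (HasSum · _) (funext fun i => ?_)).mpr h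
    rw [integral_const_mul, hfourier]
    ring
  have hGle (w : ℝ) : ‖(G w : ℂ)‖ ≤ ∫ τ, ‖(χ τ : ℂ)‖ := by
    rw [← hfourier]
    refine (norm_integral_le_integral_norm _).trans_eq ?_
    simp only [norm_mul, norm_phase, mul_one]
  have outer := hasSum_integral_of_summable_integral_norm (μ := volume)
    (F := fun i (τ : ℝ) => a i * G (ω i) *
      ((χ τ : ℂ) * Complex.exp (Complex.I * (-ω i : ℝ) * τ)))
    (fun i => (hwave (-ω i)).const_mul _) (by
      simp only [norm_mul, norm_phase, mul_one]
      simp_rw [integral_const_mul]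
      refine Summable.mul_right _ (Summable.of_nonneg_of_le (fun i => by positivity)
        (fun i => ?_) (ha.mul_right (∫ τ, ‖(χ τ : ℂ)‖)))
      exact mul_le_mul_of_nonneg_left (hGle _) (norm_nonneg _))
  rw [integral_congr_ae (Eventually.of_forall fun τ => (inner τ).tsum_eq.symm)]
  refine (congrArg (HasSum · _) (funext fun i => ?_)).mpr outer
  rw [integral_const_mul, hfourier, ← gaussian_switching_amplitude_sq hσ]
  simp only [hG, neg_sq]
  push_cast
  ring

end Gaussian

/-- Response of a Gaussian-switched inertial detector (rapidity `β`) coupled to the scalar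
density of the massless untwisted Dirac field on the flat static cylinder of circumference `L`,
with oscillator modes in their Fock vacuum and zero-mode parameter `θ ∈ [0,1]`: the `ε → 0⁺`
limit of the double integral against the untwisted correlation kernel equals the sum of a double
series (pair creation), two single series (one excitation in the zero mode), and the pure
zero-mode term. -/
theorem untwisted_inertial_response (σ L β Ω θ : ℝ) (hσ : 0 < σ) (hL : 0 < L)
    (hθ : θ ∈ Set.Icc (0 : ℝ) 1)
    (χ : ℝ → ℝ)
    (hχ : ∀ τ, χ τ = Real.pi ^ (-(1 : ℝ) / 4) * σ ^ (-(1 : ℝ) / 2) *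
      Real.exp (-τ ^ 2 / (2 * σ ^ 2))) :
    Tendsto (fun ε : ℝ =>
        ∫ τ : ℝ, ∫ τ' : ℝ,
          ((χ τ * χ τ' : ℝ) : ℂ) * Complex.exp (-Complex.I * Ω * ((τ : ℂ) - τ')) *
            (-Complex.exp (-2 * (Real.pi : ℂ) * Complex.I *
                  (((τ : ℂ) - τ') * (Real.cosh β : ℂ) - Complex.I * ε) / L) /
                (2 * (L : ℂ) ^ 2
                  * Complex.sin ((Real.pi : ℂ) *
                      ((Real.exp β : ℂ) * ((τ : ℂ) - τ') - Complex.I * ε) / L)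
                  * Complex.sin ((Real.pi : ℂ) *
                      ((Real.exp (-β) : ℂ) * ((τ : ℂ) - τ') - Complex.I * ε) / L))
              + (1 / (L : ℂ) ^ 2) *
                  (1 / (Complex.exp (2 * (Real.pi : ℂ) * Complex.I *
                      ((Real.exp β : ℂ) * ((τ : ℂ) - τ') - Complex.I * ε) / L) - 1)
                    + 1 / (Complex.exp (2 * (Real.pi : ℂ) * Complex.I *
                      ((Real.exp (-β) : ℂ) * ((τ : ℂ) - τ') - Complex.I * ε) / L) - 1))
              + (θ : ℂ) / (L : ℂ) ^ 2))
      (𝓝[>] 0)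
      (𝓝 ((((4 * Real.sqrt Real.pi * σ / L ^ 2) *
          ∑' p : ℕ × ℕ, Real.exp (-σ ^ 2 *
            (Ω + 2 * Real.pi * (((p.1 : ℝ) + 1) * Real.exp β
              + ((p.2 : ℝ) + 1) * Real.exp (-β)) / L) ^ 2))
        + ((2 * Real.sqrt Real.pi * σ / L ^ 2) *
          ∑' n : ℕ, (Real.exp (-σ ^ 2 *
              (Ω + 2 * Real.pi * ((n : ℝ) + 1) * Real.exp β / L) ^ 2)
            + Real.exp (-σ ^ 2 *
              (Ω + 2 * Real.pi * ((n : ℝ) + 1) * Real.exp (-β) / L) ^ 2)))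
        + (2 * Real.sqrt Real.pi * σ * θ / L ^ 2) * Real.exp (-σ ^ 2 * Ω ^ 2) : ℝ) : ℂ)) := by
  set S : ℕ × ℕ → ℝ := fun p =>
    Ω + 2 * Real.pi * ((p.1 : ℝ) * Real.exp β + (p.2 : ℝ) * Real.exp (-β)) / L with hS
  set D : ℝ → ℝ := fun ε => Real.exp (-(2 * Real.pi / L) * ε) with hD
  have hL' : (L : ℂ) ≠ 0 := by exact_mod_cast hL.ne'
  have hdamp {ε : ℝ} (hε : 0 < ε) : D ε < 1 :=
    Real.exp_lt_one_iff.2 (mul_neg_of_neg_of_pos (neg_neg_of_pos (by positivity)) hε)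
  have hwave (b τ τ' ε : ℝ) :
      Complex.exp (-2 * (Real.pi : ℂ) * Complex.I *
        ((b : ℂ) * ((τ : ℂ) - τ') - Complex.I * ε) / L) =
      D ε * Complex.exp (-Complex.I * (2 * Real.pi * b / L : ℝ) * ((τ : ℂ) - τ')) := by
    rw [hD, Complex.ofReal_exp, ← Complex.exp_add]
    congr 1
    push_cast
    linear_combination (2 * Real.pi * ε / L : ℂ) * Complex.I_sq
  have hnorm (b τ τ' : ℝ) {ε : ℝ} (hε : 0 < ε) :
      ‖Complex.exp (-2 * (Real.pi : ℂ) * Complex.I *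
        ((b : ℂ) * ((τ : ℂ) - τ') - Complex.I * ε) / L)‖ < 1 := by
    have hphase : -Complex.I * (2 * Real.pi * b / L : ℝ) * ((τ : ℂ) - τ') =
        ((-(2 * Real.pi * b / L) * (τ - τ') : ℝ) : ℂ) * Complex.I := by push_cast; ring
    rw [hwave, norm_mul, hphase, Complex.norm_exp_ofReal_mul_I, mul_one, Complex.norm_real,
      Real.norm_of_nonneg (Real.exp_nonneg _)]
    exact hdamp hε
  have hne {z : ℂ} (hz : ‖z‖ < 1) : z ≠ 1 := fun h => by simp [h] at hz
  have hresponse {ε : ℝ} (hε : 0 < ε) := by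
    refine hasSum_gaussian_response hσ hχ (fun i => S (ModeIndex.quanta i))
      (a := fun i => (1 / (L : ℂ) ^ 2) * (ModeIndex.weight θ i *
        ((D ε : ℂ) ^ (ModeIndex.quanta i).1 * (D ε : ℂ) ^ (ModeIndex.quanta i).2)))
      (K := fun τ τ' => Complex.exp (-Complex.I * Ω * ((τ : ℂ) - τ')) *
            (-Complex.exp (-2 * (Real.pi : ℂ) * Complex.I *
                  (((τ : ℂ) - τ') * (Real.cosh β : ℂ) - Complex.I * ε) / L) /
                (2 * (L : ℂ) ^ 2
                  * Complex.sin ((Real.pi : ℂ) *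
                      ((Real.exp β : ℂ) * ((τ : ℂ) - τ') - Complex.I * ε) / L)
                  * Complex.sin ((Real.pi : ℂ) *
                      ((Real.exp (-β) : ℂ) * ((τ : ℂ) - τ') - Complex.I * ε) / L))
              + (1 / (L : ℂ) ^ 2) *
                  (1 / (Complex.exp (2 * (Real.pi : ℂ) * Complex.I *
                      ((Real.exp β : ℂ) * ((τ : ℂ) - τ') - Complex.I * ε) / L) - 1)
                    + 1 / (Complex.exp (2 * (Real.pi : ℂ) * Complex.I *
                      ((Real.exp (-β) : ℂ) * ((τ : ℂ) - τ') - Complex.I * ε) / L) - 1))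
              + (θ : ℂ) / (L : ℂ) ^ 2)) ?_ fun τ τ' => ?_
    · have hDnorm : ‖(D ε : ℂ)‖ < 1 := by
        rw [Complex.norm_real, Real.norm_of_nonneg (Real.exp_nonneg _)]
        exact hdamp hε
      simp_rw [norm_mul (1 / (L : ℂ) ^ 2)]
      exact (ModeIndex.hasSum_weight_mul_pow θ hDnorm hDnorm).summable.norm.mul_left _
    · have hcosh : (Real.exp β : ℂ) + (Real.exp (-β) : ℂ) = 2 * (Real.cosh β : ℂ) := by
        rw [Real.cosh_eq]; push_cast; ring
      have hq := hnorm (Real.exp β) τ τ' hε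
      have hr := hnorm (Real.exp (-β)) τ τ' hε
      rw [untwisted_kernel_eq (θ : ℂ) hL' (by linear_combination ((τ : ℂ) - τ') * hcosh)
        (hne hq) (hne hr)]
      refine (congrArg (HasSum · _) (funext fun i => ?_)).mpr
        (((ModeIndex.hasSum_weight_mul_pow θ hq hr).mul_left (1 / (L : ℂ) ^ 2)).mul_left
          (Complex.exp (-Complex.I * Ω * ((τ : ℂ) - τ'))))
      rw [hwave, hwave, mul_pow, mul_pow, ← Complex.exp_nat_mul, ← Complex.exp_nat_mul]
      have hphase : Complex.exp (-Complex.I * (S (ModeIndex.quanta i) : ℝ) * ((τ : ℂ) - τ')) =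
          Complex.exp (-Complex.I * Ω * ((τ : ℂ) - τ')) *
          (Complex.exp ((ModeIndex.quanta i).1 *
              (-Complex.I * (2 * Real.pi * Real.exp β / L : ℝ) * ((τ : ℂ) - τ'))) *
            Complex.exp ((ModeIndex.quanta i).2 *
              (-Complex.I * (2 * Real.pi * Real.exp (-β) / L : ℝ) * ((τ : ℂ) - τ')))) := by
        rw [← Complex.exp_add, ← Complex.exp_add, hS]
        congr 1
        push_cast
        ring
      rw [hphase]
      ring
  have hgauss : Summable fun p => ((Real.exp (-σ ^ 2 * S p ^ 2) : ℝ) : ℂ) :=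
    Complex.summable_ofReal.2 (summable_exp_neg_sq_modes hσ hL β Ω)
  have hlimit : Tendsto (fun ε : ℝ => ∑' i, (1 / (L : ℂ) ^ 2) * (ModeIndex.weight θ i *
        ((D ε : ℂ) ^ (ModeIndex.quanta i).1 * (D ε : ℂ) ^ (ModeIndex.quanta i).2)) *
        ((2 * Real.sqrt Real.pi * σ *
          Real.exp (-σ ^ 2 * S (ModeIndex.quanta i) ^ 2) : ℝ) : ℂ)) (𝓝[>] 0)
      (𝓝 (∑' i, (2 * Real.sqrt Real.pi * σ / L ^ 2 : ℝ) * (ModeIndex.weight θ i *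
        ((Real.exp (-σ ^ 2 * S (ModeIndex.quanta i) ^ 2) : ℝ) : ℂ)))) := by
    refine tendsto_tsum_of_dominated_convergence
      ((ModeIndex.summable_norm_weight_mul θ hgauss).mul_left
        ‖((2 * Real.sqrt Real.pi * σ / L ^ 2 : ℝ) : ℂ)‖) (fun i => ?_) ?_
    · have hDcont : Continuous fun ε => (D ε : ℂ) := by fun_prop
      refine Tendsto.mono_left ?_ nhdsWithin_le_nhds
      refine Continuous.tendsto' (by fun_prop) _ _ ?_
      simp only [hD, mul_zero, Real.exp_zero, Complex.ofReal_one, one_pow, mul_one]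
      push_cast
      ring
    · filter_upwards [self_mem_nhdsWithin] with ε hε i
      have hle : ‖(D ε : ℂ) ^ (ModeIndex.quanta i).1 * (D ε : ℂ) ^ (ModeIndex.quanta i).2‖ ≤ 1 := by
        rw [← pow_add, norm_pow, Complex.norm_real, Real.norm_of_nonneg (Real.exp_nonneg _)]
        exact pow_le_one₀ (Real.exp_nonneg _) (hdamp hε).le
      rw [← norm_mul]
      refine le_trans (le_of_eq ?_) (mul_le_of_le_one_right (norm_nonneg _) hle)
      rw [← norm_mul]
      congr 1
      push_cast
      ring
  have hvalue := ((ModeIndex.hasSum_weight_mul θ hgauss).mul_left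
    ((2 * Real.sqrt Real.pi * σ / L ^ 2 : ℝ) : ℂ)).tsum_eq
  have hsingle {f : ℕ → ℕ × ℕ} (hf : f.Injective) :
      Summable fun n => Real.exp (-σ ^ 2 * S (f n) ^ 2) :=
    (summable_exp_neg_sq_modes hσ hL β Ω).comp_injective hf
  have hright := hsingle (f := fun n => (n + 1, 0)) fun m n h => by simpa using h
  have hleft := hsingle (f := fun n => (0, n + 1)) fun m n h => by simpa using h
  rw [hvalue] at hlimit
  simp_rw [← Complex.ofReal_tsum] at hlimit
  convert hlimit.congr' ?_ using 2
  · have hsplit := (hright.tsum_add hleft).symm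
    simp only [hS, Nat.cast_add, Nat.cast_one, Nat.cast_zero, zero_mul, zero_add, add_zero,
      mul_zero, zero_div, ← mul_assoc] at hsplit ⊢
    rw [← hsplit]
    push_cast
    ring
  · filter_upwards [self_mem_nhdsWithin] with ε hε
    rw [(hresponse hε).tsum_eq]
    simp_rw [mul_assoc]
end

section
/- Let Ω ∈ ℝ with Ω ≠ 0. Then the integral ∫_{−∞}^∞ dω / ( (e^ω + 1)(e^(Ω−ω) + 1) ) converges and equals Ω / ( e^Ω − 1 ); for Ω = 0 the integral equals 1. -/
open MeasureTheory

open Filter Topology in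
/-- A continuous nonnegative derivative of a function with finite limits at both ends of the line
is integrable, and its integral is the difference of the limits. -/
theorem integrable_and_integral_eq_of_hasDerivAt_of_nonneg {f f' : ℝ → ℝ} {m n : ℝ}
    (hderiv : ∀ x, HasDerivAt f (f' x) x) (hcont : Continuous f') (hnonneg : ∀ x, 0 ≤ f' x)
    (hbot : Tendsto f atBot (𝓝 m)) (htop : Tendsto f atTop (𝓝 n)) :
    Integrable f' ∧ ∫ x, f' x = n - m := by
  have hint : Integrable f' := by
    refine integrable_of_intervalIntegral_norm_tendsto (a := fun t : ℝ => -t) (b := id)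
      (l := atTop) (n - m) (fun t => (hcont.integrableOn_Icc).mono_set Set.Ioc_subset_Icc_self)
      tendsto_neg_atTop_atBot tendsto_id ?_
    refine (htop.sub (hbot.comp tendsto_neg_atTop_atBot)).congr fun t => ?_
    simp only [Real.norm_of_nonneg (hnonneg _), id, Function.comp]
    exact (intervalIntegral.integral_eq_sub_of_hasDerivAt (fun x _ => hderiv x)
      (hcont.intervalIntegrable _ _)).symm
  exact ⟨hint, integral_of_hasDerivAt_of_tendsto hderiv hint hbot htop⟩

theorem continuous_fermi_dirac_convolution_integrand (Ω : ℝ) :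
    Continuous fun ω : ℝ => 1 / ((Real.exp ω + 1) * (Real.exp (Ω - ω) + 1)) :=
  continuous_const.div (by fun_prop) fun _ => by positivity

open Filter Topology in
theorem integrable_and_integral_fermi_dirac_of_ne_zero {Ω : ℝ} (hΩ : Ω ≠ 0) :
    Integrable (fun ω : ℝ => 1 / ((Real.exp ω + 1) * (Real.exp (Ω - ω) + 1)))
    ∧ ∫ ω : ℝ, 1 / ((Real.exp ω + 1) * (Real.exp (Ω - ω) + 1)) = Ω / (Real.exp Ω - 1) := by
  have hE : Real.exp Ω - 1 ≠ 0 := sub_ne_zero.mpr (by simpa using hΩ)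
  have key := integrable_and_integral_eq_of_hasDerivAt_of_nonneg
    (f := fun ω => -Real.log ((Real.exp ω + Real.exp Ω) / (Real.exp ω + 1)) / (Real.exp Ω - 1))
    (f' := fun ω : ℝ => 1 / ((Real.exp ω + 1) * (Real.exp (Ω - ω) + 1)))
    (m := -Ω / (Real.exp Ω - 1)) (n := 0) ?_
    (continuous_fermi_dirac_convolution_integrand Ω) (fun _ => by positivity) ?_ ?_
  · refine ⟨key.1, key.2.trans (by ring)⟩
  · intro ω
    have h1 : Real.exp ω + 1 ≠ 0 := by positivity
    have h2 : Real.exp ω + Real.exp Ω ≠ 0 := by positivity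
    have h3 : (Real.exp ω + Real.exp Ω) / (Real.exp ω + 1) ≠ 0 := div_ne_zero h2 h1
    have h := (((((Real.hasDerivAt_exp ω).add_const (Real.exp Ω)).fun_div
      ((Real.hasDerivAt_exp ω).add_const 1) h1).log h3).fun_neg).div_const (Real.exp Ω - 1)
    refine h.congr_deriv ?_
    have h4 : Real.exp Ω + Real.exp ω ≠ 0 := by positivity
    rw [Real.exp_sub]
    field_simp
    ring
  · have h : Tendsto (fun ω => (Real.exp ω + Real.exp Ω) / (Real.exp ω + 1)) atBot
        (𝓝 ((0 + Real.exp Ω) / (0 + 1))) :=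
      (Real.tendsto_exp_atBot.add_const _).div (Real.tendsto_exp_atBot.add_const _) (by norm_num)
    simpa using ((h.log (by positivity)).neg).div_const (Real.exp Ω - 1)
  · have h : Tendsto (fun ω => (1 + Real.exp Ω * Real.exp (-ω)) / (1 + Real.exp (-ω))) atTop
        (𝓝 ((1 + Real.exp Ω * 0) / (1 + 0))) :=
      ((Real.tendsto_exp_neg_atTop_nhds_zero.const_mul _).const_add 1).div
        (Real.tendsto_exp_neg_atTop_nhds_zero.const_add 1) (by norm_num)
    have h' : Tendsto (fun ω => (Real.exp ω + Real.exp Ω) / (Real.exp ω + 1)) atTop (𝓝 1) := by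
      simp only [mul_zero, add_zero, div_one] at h
      refine h.congr fun ω => ?_
      rw [Real.exp_neg]
      field_simp
    simpa using ((h'.log one_ne_zero).neg).div_const (Real.exp Ω - 1)

open Filter Topology in
theorem integrable_and_integral_fermi_dirac_zero :
    Integrable (fun ω : ℝ => 1 / ((Real.exp ω + 1) * (Real.exp (0 - ω) + 1)))
    ∧ ∫ ω : ℝ, 1 / ((Real.exp ω + 1) * (Real.exp (0 - ω) + 1)) = 1 := by
  have key := integrable_and_integral_eq_of_hasDerivAt_of_nonneg
    (f := fun ω => -(Real.exp ω + 1)⁻¹)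
    (f' := fun ω : ℝ => 1 / ((Real.exp ω + 1) * (Real.exp (0 - ω) + 1)))
    (m := -1) (n := 0) ?_
    (continuous_fermi_dirac_convolution_integrand 0) (fun _ => by positivity) ?_ ?_
  · exact ⟨key.1, key.2.trans (by norm_num)⟩
  · intro ω
    have h1 : Real.exp ω + 1 ≠ 0 := by positivity
    refine ((((Real.hasDerivAt_exp ω).add_const 1).fun_inv h1).fun_neg).congr_deriv ?_
    rw [Real.exp_sub, Real.exp_zero]
    field_simp
    ring
  · simpa using ((Real.tendsto_exp_atBot.add_const 1).inv₀ (by norm_num)).neg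
  · simpa using (tendsto_inv_atTop_zero.comp
      (tendsto_atTop_add_const_right _ 1 Real.tendsto_exp_atTop)).neg

/-- Self-convolution of Fermi-Dirac factors produces the Planckian form:
`∫_{−∞}^∞ dω / ((e^ω + 1)(e^{Ω−ω} + 1))` converges, and it equals `Ω/(e^Ω − 1)` for `Ω ≠ 0`
and `1` for `Ω = 0`. -/
theorem fermi_dirac_self_convolution_planckian (Ω : ℝ) :
    Integrable (fun ω : ℝ => 1 / ((Real.exp ω + 1) * (Real.exp (Ω - ω) + 1)))
    ∧ (Ω ≠ 0 → ∫ ω : ℝ, 1 / ((Real.exp ω + 1) * (Real.exp (Ω - ω) + 1))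
        = Ω / (Real.exp Ω - 1))
    ∧ (Ω = 0 → ∫ ω : ℝ, 1 / ((Real.exp ω + 1) * (Real.exp (Ω - ω) + 1)) = 1) := by
  rcases eq_or_ne Ω 0 with rfl | hΩ
  · exact ⟨integrable_and_integral_fermi_dirac_zero.1, fun h => absurd rfl h,
      fun _ => integrable_and_integral_fermi_dirac_zero.2⟩
  · exact ⟨(integrable_and_integral_fermi_dirac_of_ne_zero hΩ).1,
      fun _ => (integrable_and_integral_fermi_dirac_of_ne_zero hΩ).2, fun h => absurd h hΩ⟩
end
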